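/- Let $I \subseteq \mathbb{R}$ be an open interval and $f : I \to (0,\infty)$ a smooth function with $(\log f)''(t) \le 0$ for all $t \in I$. Then there is no smooth doubly periodic function $u : \mathbb{R}^2 \to \mathbb{R}$ with $u(\mathbb{R}^2) \subseteq I$ and $|Du| < f(u)$ everywhere such that for all points $p, q \in \mathbb{R}^2$ one has $H(u)(p)^2 < \dfrac{f'(u(q))^2}{f(u(q))^2}$. -/

import Mathlib

noncomputable section

/-- The Euclidean plane. -/
abbrev E2 : Type := EuclideanSpace ℝ (Fin 2)

/-- Euclidean divergence of a vector field on the plane: the trace of its derivative. -/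
def divergence (V : E2 → E2) (p : E2) : ℝ :=
  LinearMap.trace ℝ E2 (fderiv ℝ V p).toLinearMap

/-- The mean curvature operator `H(u)` of the spacelike graph of `u` in the GRW spacetime
`I ×_f ℝ²`:
`H(u) = - div (Du / (2 f(u) √(f(u)² - |Du|²))) - (f'(u) / (2 √(f(u)² - |Du|²))) (2 + |Du|²/f(u)²)`. -/
def Hmean (f : ℝ → ℝ) (u : E2 → ℝ) (p : E2) : ℝ :=
  - divergence
      (fun q => (2 * f (u q) * Real.sqrt ((f (u q)) ^ 2 - ‖gradient u q‖ ^ 2))⁻¹ • gradient u q) p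
  - deriv f (u p) / (2 * Real.sqrt ((f (u p)) ^ 2 - ‖gradient u p‖ ^ 2)) *
      (2 + ‖gradient u p‖ ^ 2 / (f (u p)) ^ 2)

/-- A function on the plane is doubly periodic if it is invariant under translation by
every vector of `ℤ²`. -/
def DoublyPeriodic (u : E2 → ℝ) : Prop :=
  ∀ p : E2, ∀ k : Fin 2 → ℤ,
    u (p + (WithLp.equiv 2 (Fin 2 → ℝ)).symm (fun i => (k i : ℝ))) = u p

end

lemma aux_second (φ : ℝ → ℝ) (hφ : ContDiff ℝ 2 φ) (h : IsLocalMax φ 0) :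
    deriv (deriv φ) 0 ≤ 0 := by
  by_contra! hc
  have h2 := isLocalMin_of_deriv_deriv_pos hc h.deriv_eq_zero hφ.continuous.continuousAt
  have h3 : φ =ᶠ[nhds 0] fun _ => φ 0 := by
    filter_upwards [h, h2] with x a b
    exact le_antisymm a b
  have h4 := h3.deriv.deriv_eq
  simp at h4
  linarith

lemma aux_gradDiff (u : E2 → ℝ) (hu : ContDiff ℝ (⊤ : ℕ∞) u) : Differentiable ℝ (gradient u) := by
  have h1 : Differentiable ℝ (fderiv ℝ u) :=
    (hu.fderiv_right (m := 1) (by norm_cast)).differentiable (by norm_num)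
  exact (InnerProductSpace.toDual ℝ E2).symm.toContinuousLinearEquiv.differentiable.comp h1

lemma aux_trace (u : E2 → ℝ) (hu : ContDiff ℝ (⊤ : ℕ∞) u) (p : E2) (h : ∀ q, u q ≤ u p) :
    divergence (gradient u) p ≤ 0 := by
  unfold divergence
  rw [LinearMap.trace_eq_sum_inner _ (EuclideanSpace.basisFun (Fin 2) ℝ)]
  apply Finset.sum_nonpos
  intro i _
  set e := EuclideanSpace.basisFun (Fin 2) ℝ i
  have hd : Differentiable ℝ u := hu.differentiable (by simp)
  have hl : ∀ t : ℝ, HasDerivAt (fun t : ℝ => p + t • e) e t := fun t => by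
    simpa using ((hasDerivAt_id t).smul_const e).const_add p
  have h1 : deriv (fun t : ℝ => u (p + t • e)) = fun t => inner ℝ e (gradient u (p + t • e)) := by
    funext t
    have := ((hd (p + t • e)).hasFDerivAt.comp_hasDerivAt t (hl t)).deriv
    rw [real_inner_comm, gradient, InnerProductSpace.toDual_symm_apply]
    exact this
  have h2 : deriv (deriv (fun t : ℝ => u (p + t • e))) 0 = inner ℝ e (fderiv ℝ (gradient u) p e) := by
    rw [h1]
    have h3 := (aux_gradDiff u hu (p + (0:ℝ) • e)).hasFDerivAt.comp_hasDerivAt (0:ℝ) (hl 0)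
    have h4 := (hasDerivAt_const (0:ℝ) e).inner ℝ h3
    have h5 := h4.deriv
    simpa using h5
  have := aux_second (fun t : ℝ => u (p + t • e)) (by
    have := hu.of_le (show (2 : WithTop ℕ∞) ≤ _ from WithTop.coe_le_coe.2 le_top)
    fun_prop) (Filter.Eventually.of_forall fun t => by simpa using h _)
  rw [h2] at this
  exact this

lemma aux_grad_neg (u : E2 → ℝ) : gradient (fun q => - u q) = fun q => - gradient u q := by
  funext q
  simp [gradient, fderiv_fun_neg]

lemma aux_trace_min (u : E2 → ℝ) (hu : ContDiff ℝ (⊤ : ℕ∞) u) (p : E2) (h : ∀ q, u p ≤ u q) :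
    0 ≤ divergence (gradient u) p := by
  have := aux_trace (fun q => - u q) hu.neg p (fun q => neg_le_neg (h q))
  rw [aux_grad_neg] at this
  unfold divergence at *
  rw [fderiv_fun_neg] at this
  simpa using this

lemma aux_H (I : Set ℝ) (hI : IsOpen I) 
    (f : ℝ → ℝ) (hf : ContDiffOn ℝ (⊤ : ℕ∞) f I) (hfpos : ∀ t ∈ I, 0 < f t)
    (u : E2 → ℝ) (hu : ContDiff ℝ (⊤ : ℕ∞) u) (p : E2) (hp : u p ∈ I) (hg : gradient u p = 0) :
    Hmean f u p = - ((2 * f (u p) ^ 2)⁻¹ * divergence (gradient u) p) - deriv f (u p) / f (u p) := by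
  have hpos := hfpos _ hp
  have hG := aux_gradDiff u hu p
  have hd : DifferentiableAt ℝ u p := hu.differentiable (by simp) p
  have hfd : DifferentiableAt ℝ f (u p) :=
    ((hf.contDiffAt (hI.mem_nhds hp)).differentiableAt (by simp))
  have hfu : DifferentiableAt ℝ (fun q => f (u q)) p := hfd.comp p hd
  have hn : DifferentiableAt ℝ (fun q => ‖gradient u q‖ ^ 2) p := hG.norm_sq ℝ
  have hs : Real.sqrt (f (u p) ^ 2 - ‖gradient u p‖ ^ 2) = f (u p) := by
    simp [hg, Real.sqrt_sq hpos.le]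
  have hc : DifferentiableAt ℝ (fun q => (2 * f (u q) * Real.sqrt ((f (u q)) ^ 2 - ‖gradient u q‖ ^ 2))⁻¹) p := by
    have h1 : DifferentiableAt ℝ (fun q => Real.sqrt ((f (u q)) ^ 2 - ‖gradient u q‖ ^ 2)) p :=
      ((hfu.pow 2).sub hn).sqrt (by simp [hg]; exact hpos.ne')
    exact ((hfu.const_mul 2).mul h1).inv (by
      simp only [Pi.mul_apply, hs]; positivity)
  unfold Hmean
  unfold divergence
  rw [fderiv_fun_smul hc hG, hs, hg]
  simp
  field_simp

lemma aux_max (u : E2 → ℝ) (hu : Continuous u) (hper : DoublyPeriodic u) :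
    ∃ p, ∀ q, u q ≤ u p := by
  have hK : IsCompact ((WithLp.toLp 2 : (Fin 2 → ℝ) → E2) '' Set.Icc 0 1) :=
    isCompact_Icc.image (PiLp.continuous_toLp 2 _)
  obtain ⟨p, _, hp⟩ := hK.exists_isMaxOn ⟨_, 0, by simp, rfl⟩ hu.continuousOn
  refine ⟨p, fun q => ?_⟩
  rw [← hper q (fun i => - ⌊q i⌋)]
  apply hp
  refine ⟨fun i => Int.fract (q i), ⟨fun i => Int.fract_nonneg _, fun i => (Int.fract_lt_one _).le⟩, ?_⟩
  ext i
  simp [Int.fract, sub_eq_add_neg]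

/-- Corollary 3.6 (nonexistence part) on the flat torus: if `(log f)'' ≤ 0`
on `I`, there is no smooth doubly periodic `u` with `|Du| < f(u)` such that
`H(u)(p)² < f'(u(q))²/f(u(q))²` for all points `p, q`. -/
theorem stmt10 (I : Set ℝ) (hI : IsOpen I) (hIc : I.OrdConnected)
    (f : ℝ → ℝ) (hf : ContDiffOn ℝ (⊤ : ℕ∞) f I) (hfpos : ∀ t ∈ I, 0 < f t)
    (hlog : ∀ t ∈ I, deriv (deriv (fun s => Real.log (f s))) t ≤ 0) :
    ¬ ∃ u : E2 → ℝ, ContDiff ℝ (⊤ : ℕ∞) u ∧ (∀ p, u p ∈ I) ∧ DoublyPeriodic u ∧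
      (∀ p, ‖gradient u p‖ < f (u p)) ∧
      (∀ p q : E2, (Hmean f u p) ^ 2 < (deriv f (u q)) ^ 2 / (f (u q)) ^ 2) := by
  rintro ⟨u, hu, huI, hper, -, hH⟩
  obtain ⟨p, hp⟩ := aux_max u hu.continuous hper
  obtain ⟨m, hm'⟩ := aux_max (fun q => - u q) hu.continuous.neg
    (fun q k => congrArg Neg.neg (hper q k))
  have hm : ∀ q, u m ≤ u q := fun q => neg_le_neg_iff.1 (hm' q)
  have gz : ∀ q, fderiv ℝ u q = 0 → gradient u q = 0 := fun q h => by simp [gradient, h]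
  have gp : gradient u p = 0 :=
    gz p (IsLocalMax.fderiv_eq_zero (Filter.Eventually.of_forall hp))
  have gm : gradient u m = 0 :=
    gz m (IsLocalMin.fderiv_eq_zero (Filter.Eventually.of_forall hm))
  have Hp := aux_H I hI f hf hfpos u hu p (huI p) gp
  have Hm := aux_H I hI f hf hfpos u hu m (huI m) gm
  have tp := aux_trace u hu p hp
  have tm := aux_trace_min u hu m hm
  have fp := hfpos _ (huI p)
  have fm := hfpos _ (huI m)
  have kp : (2 * f (u p) ^ 2)⁻¹ * divergence (gradient u) p ≤ 0 :=
    mul_nonpos_of_nonneg_of_nonpos (by positivity) tp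
  have km : 0 ≤ (2 * f (u m) ^ 2)⁻¹ * divergence (gradient u) m := by positivity
  have sp : 0 ≤ deriv f (u p) := by
    by_contra! hc
    have h1 := hH p p
    rw [← div_pow, Hp] at h1
    have h2 := div_neg_of_neg_of_pos hc fp
    nlinarith
  have sm : deriv f (u m) ≤ 0 := by
    by_contra! hc
    have h1 := hH m m
    rw [← div_pow, Hm] at h1
    have h2 := div_pos hc fm
    nlinarith
  have hcont : Continuous (fun q => deriv f (u q)) :=
    (hf.continuousOn_deriv_of_isOpen hI (by simp)).comp_continuous hu.continuous huI
  obtain ⟨q, hq⟩ := mem_range_of_exists_le_of_exists_ge hcont ⟨m, sm⟩ ⟨p, sp⟩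
  have h1 := hH q q
  simp only at hq
  rw [hq] at h1
  simp at h1
  nlinarith [sq_nonneg (Hmean f u q)]
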